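/- arXiv:2605.19475 — 2 statements merged into one kernel-verified Lean document; each statement's English description precedes it below -/
import Mathlib

section
/- Let a ∈ ℂ and N ∈ ℕ. For 0 ≤ k ≤ N define aₖ(x) = (x+a)ₖ·(x+1−a−N)_{N−k} and for i ∈ ℕ define sᵢ(x) = (x+a)ᵢ, where (z)ₘ denotes the Pochhammer symbol. Then for every 0 ≤ k ≤ N and all x ∈ ℂ, aₖ(x) = Σ_{i=k}^{N} (−1)^{i+N} · binom(N−k, i−k) · (k+2a+i)_{N−i} · sᵢ(x), where binom denotes the ordinary binomial coefficient. -/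
/-- The Pochhammer symbol `(z)ₘ = z (z+1) ⋯ (z+m-1)`. -/
noncomputable def poch (z : ℂ) (m : ℕ) : ℂ := ∏ i ∈ Finset.range m, (z + i)

/-- The basis `aₖ(x) = (x+a)ₖ (x+1-a-N)_{N-k}`. -/
noncomputable def aFun (a : ℂ) (N k : ℕ) (x : ℂ) : ℂ :=
  poch (x + a) k * poch (x + 1 - a - N) (N - k)

/-- The split basis `sᵢ(x) = (x+a)ᵢ`. -/
noncomputable def sFun (a : ℂ) (i : ℕ) (x : ℂ) : ℂ := poch (x + a) i

theorem poch_succ (z : ℂ) (m : ℕ) : poch z (m + 1) = poch z m * (z + m) :=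
  Finset.prod_range_succ _ _

theorem poch_add (z : ℂ) (m n : ℕ) : poch z (m + n) = poch z m * poch (z + m) n := by
  simp only [poch, Finset.prod_range_add, Nat.cast_add, add_assoc]

theorem poch_succ' (z : ℂ) (m : ℕ) : poch z (m + 1) = z * poch (z + 1) m := by
  rw [add_comm, poch_add]
  simp [poch]

/-- A form of the Chu–Vandermonde identity, written for the falling factorial of `y - b`. -/
theorem sum_choose_mul_poch (n : ℕ) (b y : ℂ) :
    ∑ j ∈ Finset.range (n + 1),
      (n.choose j : ℂ) * ((-1) ^ (j + n) * poch (b + j) (n - j) * poch y j) =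
        poch (y - b + 1 - n) n := by
  induction n generalizing b y with
  | zero => simp [poch]
  | succ n ih =>
    have hsplit := Finset.sum_choose_succ_mul
      (fun i m => (-1 : ℂ) ^ (i + (n + 1)) * poch (b + i) m * poch y i) n
    have hfirst : ∑ i ∈ Finset.range (n + 1),
        (n.choose i : ℂ) * ((-1) ^ (i + (n + 1)) * poch (b + i) (n + 1 - i) * poch y i) =
          -(b + n) * poch (y - b + 1 - n) n := by
      rw [← ih, Finset.mul_sum]
      refine Finset.sum_congr rfl fun i hi => ?_
      have hin : i ≤ n := Nat.lt_succ_iff.mp (Finset.mem_range.mp hi)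
      rw [Nat.succ_sub hin, Nat.succ_eq_add_one, poch_succ, Nat.cast_sub hin]
      ring
    have hsecond : ∑ i ∈ Finset.range (n + 1),
        (n.choose i : ℂ) *
          ((-1) ^ (i + 1 + (n + 1)) * poch (b + (i + 1 : ℕ)) (n - i) * poch y (i + 1)) =
          y * poch (y - b + 1 - n) n := by
      rw [show y - b + 1 - n = (y + 1) - (b + 1) + 1 - n by ring, ← ih, Finset.mul_sum]
      refine Finset.sum_congr rfl fun i _ => ?_
      rw [poch_succ', show b + (i + 1 : ℕ) = b + 1 + i by push_cast; ring]
      ring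
    rw [hsplit, hfirst, hsecond, poch_succ',
      show y - b + 1 - (n + 1 : ℕ) + 1 = y - b + 1 - n by push_cast; ring]
    push_cast
    ring

/-- Connection formula: `aₖ = Σ_{i=k}^{N} (-1)^{i+N} binom(N-k, i-k) (k+2a+i)_{N-i} sᵢ`. -/
theorem a_in_terms_of_s (a : ℂ) (N k : ℕ) (hk : k ≤ N) (x : ℂ) :
    aFun a N k x =
      ∑ i ∈ Finset.Icc k N,
        (-1 : ℂ) ^ (i + N) * (Nat.choose (N - k) (i - k) : ℂ)
          * poch ((k : ℂ) + 2 * a + i) (N - i) * sFun a i x := by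
  obtain ⟨n, rfl⟩ := Nat.exists_eq_add_of_le hk
  rw [← Finset.Ico_add_one_right_eq_Icc, Finset.sum_Ico_eq_sum_range,
    show k + n + 1 - k = n + 1 by omega]
  simp only [aFun, sFun, Nat.add_sub_cancel_left, Nat.add_sub_add_left]
  rw [show x + 1 - a - (k + n : ℕ) = (x + a + k) - (2 * a + 2 * k) + 1 - n by push_cast; ring,
    ← sum_choose_mul_poch, Finset.mul_sum]
  refine Finset.sum_congr rfl fun j _ => ?_
  rw [poch_add, show (k : ℂ) + 2 * a + (k + j : ℕ) = 2 * a + 2 * k + j by push_cast; ring,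
    show k + j + (k + n) = 2 * k + (j + n) by ring, pow_add _ (2 * k), pow_mul, neg_one_sq, one_pow]
  ring
end

section
/- Let a, c ∈ ℂ and N ∈ ℕ, and assume a+c+m ≠ 0 for every integer 0 ≤ m ≤ 2N. For 0 ≤ k ≤ N and ℓ ∈ ℤ define the Hahn rational function value Uₖ(ℓ; a, c', N) = Σ_{j=0}^{k} [ (−k)ⱼ · (−ℓ)ⱼ · (k+2a−1)ⱼ ] / [ (a−c'−ℓ)ⱼ · (−N)ⱼ · j! ], whenever the denominators are nonzero. Define aₖ(x) = (x+a)ₖ·(x+1−a−N)_{N−k} and bₗ(x) = (x+c)ₗ. Then for every 0 ≤ k ≤ N and all x ∈ ℂ, aₖ(x) = Σ_{ℓ=0}^{N} binom(N, ℓ) · (1−a−c−N)_{N−ℓ} · Uₖ(N−ℓ; a, −c−N, N) · bₗ(x), where binom denotes the ordinary binomial coefficient. (Here the lower Pochhammer parameter of Uₖ(N−ℓ; a, −c−N, N) is a−(−c−N)−(N−ℓ) = a+c+ℓ, which is nonvanishing along the sum by the assumption.) -/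
/-- The Hahn rational function
`Uₖ(ℓ; a, c', N) = Σ_{j=0}^{k} (-k)ⱼ (-ℓ)ⱼ (k+2a-1)ⱼ / ((a-c'-ℓ)ⱼ (-N)ⱼ j!)`,
with the argument `ℓ` allowed to be any complex number (in particular any integer). -/
noncomputable def hahnU (a c' : ℂ) (N k : ℕ) (l : ℂ) : ℂ :=
  ∑ j ∈ Finset.range (k + 1),
    (poch (-(k : ℂ)) j * poch (-l) j * poch ((k : ℂ) + 2 * a - 1) j) /
      (poch (a - c' - l) j * poch (-(N : ℂ)) j * (Nat.factorial j : ℂ))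

/-- The basis `bₗ(x) = (x+c)ₗ`. -/
noncomputable def bFun (c : ℂ) (l : ℕ) (x : ℂ) : ℂ := poch (x + c) l

theorem poch_reflect (z : ℂ) (n : ℕ) : poch (1 - z - n) n = (-1) ^ n * poch z n := by
  have h : (-1 : ℂ) ^ n = ∏ _i ∈ Finset.range n, (-1 : ℂ) := by simp
  rw [poch, poch, h, ← Finset.prod_mul_distrib,
    ← Finset.prod_range_reflect (fun i : ℕ => -1 * (z + (i : ℂ)))]
  refine Finset.prod_congr rfl fun i hi => ?_
  have hi' : i + 1 ≤ n := Finset.mem_range.mp hi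
  rw [Nat.sub_sub, add_comm 1 i, Nat.cast_sub hi']
  push_cast
  ring

theorem poch_neg_natCast (n j : ℕ) :
    poch (-(n : ℂ)) j = (-1) ^ j * (j.factorial * n.choose j : ℕ) := by
  rw [← Nat.descFactorial_eq_factorial_mul_choose]
  induction j with
  | zero => simp [poch]
  | succ j ih =>
    rw [poch_succ, ih, Nat.descFactorial_succ]
    rcases le_or_gt j n with h | h
    · push_cast [Nat.cast_sub h]
      ring
    · simp [Nat.descFactorial_of_lt h]

/-- The Chu–Vandermonde identity for rising factorials. -/
theorem sum_choose_mul_poch_mul_poch (u v : ℂ) (n : ℕ) :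
    ∑ l ∈ Finset.range (n + 1), (n.choose l : ℂ) * (poch u l * poch v (n - l)) =
      poch (u + v) n := by
  rw [← Finset.Nat.sum_antidiagonal_eq_sum_range_succ
    (fun i j => (n.choose i : ℂ) * (poch u i * poch v j))]
  induction n with
  | zero => simp [poch]
  | succ n ih =>
    rw [Finset.sum_antidiagonal_choose_succ_mul (fun i j => poch u i * poch v j), poch_succ, ← ih,
      ← Finset.sum_add_distrib, Finset.sum_mul]
    refine Finset.sum_congr rfl fun p hp => ?_
    have hn := Finset.HasAntidiagonal.mem_antidiagonal.mp hp
    rw [← hn, Nat.choose_symm_add, poch_succ, poch_succ]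
    push_cast
    ring

theorem choose_mul_choose_sub_comm (N l j : ℕ) :
    N.choose l * (N - l).choose j = N.choose j * (N - j).choose l := by
  have h₁ := Nat.choose_mul (n := N) (k := l + j) (s := l) (by omega)
  have h₂ := Nat.choose_mul (n := N) (k := l + j) (s := j) (by omega)
  rw [Nat.add_sub_cancel_left] at h₁
  rw [Nat.add_sub_cancel] at h₂
  rw [← h₁, ← h₂, Nat.choose_symm_add]

theorem choose_mul_poch_mul_hahnU_term (a c : ℂ) (N : ℕ)
    (hac : ∀ m ≤ 2 * N, a + c + (m : ℂ) ≠ 0) (k j l : ℕ) (hjN : j ≤ N) (hl : l ≤ N) :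
    (N.choose l : ℂ) * poch (1 - a - c - N) (N - l) *
      ((poch (-(k : ℂ)) j * poch (-((N : ℂ) - l)) j * poch ((k : ℂ) + 2 * a - 1) j) /
        (poch (a - (-c - N) - ((N : ℂ) - l)) j * poch (-(N : ℂ)) j * (Nat.factorial j : ℂ))) =
    (k.choose j : ℂ) * poch ((k : ℂ) + 2 * a - 1) j *
      (((N - j).choose l : ℂ) * poch (1 - a - c - N) (N - j - l)) := by
  have hden : poch (a - (-c - N) - ((N : ℂ) - l)) j ≠ 0 := by
    refine Finset.prod_ne_zero_iff.mpr fun i hi => ?_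
    have hi' := Finset.mem_range.mp hi
    convert hac (l + i) (by omega) using 1
    push_cast
    ring
  rw [← Nat.cast_sub hl]
  rw [← Nat.cast_sub hl] at hden
  simp only [poch_neg_natCast]
  rcases le_or_gt (l + j) N with h | h
  · obtain ⟨m, rfl⟩ := Nat.exists_eq_add_of_le h
    have hsplit : poch (1 - a - c - ((l + j + m : ℕ) : ℂ)) (l + j + m - l) =
        poch (1 - a - c - ((l + j + m : ℕ) : ℂ)) m *
          ((-1) ^ j * poch (a - (-c - ((l + j + m : ℕ) : ℂ)) - ((l + j + m - l : ℕ) : ℂ)) j) := by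
      rw [← poch_reflect, show l + j + m - l = m + j by omega, poch_add]
      congr 2
      push_cast
      ring
    have hch : ((l + j + m).choose l : ℂ) * ((l + j + m - l).choose j : ℂ) =
        (l + j + m).choose j * (l + j + m - j).choose l := by
      exact_mod_cast choose_mul_choose_sub_comm _ l j
    have hN : ((l + j + m).choose j : ℂ) ≠ 0 := by
      exact_mod_cast (Nat.choose_pos hjN).ne'
    have hj : (j.factorial : ℂ) ≠ 0 := by exact_mod_cast j.factorial_ne_zero
    have hs : ((-1 : ℂ) ^ j) * (-1) ^ j = 1 := by rw [← mul_pow]; simp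
    have hs0 : ((-1 : ℂ) ^ j) ≠ 0 := by simp
    rw [hsplit, show l + j + m - j - l = m by omega]
    generalize poch (a - (-c - ((l + j + m : ℕ) : ℂ)) - ((l + j + m - l : ℕ) : ℂ)) j = D at *
    generalize poch (1 - a - c - ((l + j + m : ℕ) : ℂ)) m = P at *
    generalize poch ((k : ℂ) + 2 * a - 1) j = Q at *
    simp only [Nat.cast_mul]
    generalize (-1 : ℂ) ^ j = s at *
    rw [mul_div_assoc', div_eq_iff (by simp [*])]
    linear_combination (P * D * s ^ 3 * (j.factorial : ℂ) ^ 2 * k.choose j * Q) * hch +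
      (k.choose j * (j.factorial : ℂ) ^ 2 * Q * P * D * s *
        ((l + j + m).choose j * (l + j + m - j).choose l)) * hs
  · rw [Nat.choose_eq_zero_of_lt (show N - l < j by omega),
      Nat.choose_eq_zero_of_lt (show N - j < l by omega)]
    simp

theorem sum_choose_mul_poch_mul_bFun (a c x : ℂ) (N j : ℕ) :
    ∑ l ∈ Finset.range (N + 1),
        ((N - j).choose l : ℂ) * poch (1 - a - c - N) (N - j - l) * bFun c l x =
      poch (x + 1 - a - N) (N - j) := by
  rw [← Finset.sum_subset (Finset.range_subset_range.mpr (show N - j + 1 ≤ N + 1 by omega))]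
  · rw [show x + 1 - a - N = (x + c) + (1 - a - c - N) by ring, ← sum_choose_mul_poch_mul_poch]
    refine Finset.sum_congr rfl fun l _ => ?_
    rw [bFun]
    ring
  · intro l _ hl
    rw [Finset.mem_range, not_lt] at hl
    simp [Nat.choose_eq_zero_of_lt (show N - j < l from hl)]

/-- Connection formula expanding `aₖ` over the basis `bₗ` with Hahn rational coefficients:
`aₖ = Σ_{ℓ=0}^{N} binom(N, ℓ) (1-a-c-N)_{N-ℓ} Uₖ(N-ℓ; a, -c-N, N) bₗ`. -/
theorem a_in_terms_of_b (a c : ℂ) (N : ℕ)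
    (hac : ∀ m ≤ 2 * N, a + c + (m : ℂ) ≠ 0)
    (k : ℕ) (hk : k ≤ N) (x : ℂ) :
    aFun a N k x =
      ∑ l ∈ Finset.range (N + 1),
        (Nat.choose N l : ℂ) * poch (1 - a - c - N) (N - l)
          * hahnU a (-c - N) N k ((N : ℂ) - l) * bFun c l x := by
  simp only [hahnU, Finset.mul_sum, Finset.sum_mul]
  rw [Finset.sum_comm, aFun,
    show x + a = ((k : ℂ) + 2 * a - 1) + (x + 1 - a - k) by ring,
    ← sum_choose_mul_poch_mul_poch, Finset.sum_mul]
  refine Finset.sum_congr rfl fun j hj => ?_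
  have hjk : j ≤ k := Finset.mem_range_succ_iff.mp hj
  have hterm : ∀ l ∈ Finset.range (N + 1), _ := fun l hl =>
    congrArg (· * bFun c l x) (choose_mul_poch_mul_hahnU_term a c N hac k j l (hjk.trans hk)
      (Finset.mem_range_succ_iff.mp hl))
  rw [Finset.sum_congr rfl hterm]
  simp only [mul_assoc ((k.choose j : ℂ) * _)]
  rw [← Finset.mul_sum, sum_choose_mul_poch_mul_bFun,
    show N - j = (N - k) + (k - j) by omega, poch_add,
    show x + 1 - a - N + ((N - k : ℕ) : ℂ) = x + 1 - a - k by
      rw [Nat.cast_sub hk]; ring]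
  ring
end
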